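/- Let the potentials K, W satisfy conditions (C1)–(C6), set M := sup{W(t,q) : t ∈ ℝ, |q| = 1} and b̄₁ := min{1, 2b₁}, and assume M < (1/2)b̄₁. If f : ℝ → ℝⁿ is continuous, bounded, and its L² norm satisfies (∫_{-∞}^{∞} |f(t)|² dt)^{1/2} < (√2/4)(b̄₁ − 2M), then there exists a twice continuously differentiable function q : ℝ → ℝⁿ such that q̈(t) − ∇_qK(t, q(t)) + ∇_qW(t, q(t)) = f(t) for all t ∈ ℝ, and both q(t) → 0 and q̇(t) → 0 as t → ±∞. -/

import Mathlib

open MeasureTheory Filter RealInnerProductSpace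

/-- Discrete first-order expansion of a sequence whose increments are close to a fixed vector. -/
lemma norm_sub_sub_zsmul_le {E : Type*} [NormedAddCommGroup E] [NormedSpace ℝ E]
    (y : ℤ → E) (w : E) (η : ℝ) {i k : ℤ} (hik : i ≤ k)
    (h : ∀ j, i ≤ j → j < k → ‖y (j + 1) - y j - w‖ ≤ η) :
    ‖y k - y i - ((k : ℝ) - i) • w‖ ≤ ((k : ℝ) - i) * η := by
  induction k, hik using Int.leInduction with
  | base => simp
  | succ k hk ih =>
    have h1 := ih fun j hj hj' => h j hj (by omega)
    have h2 := h k hk (by omega)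
    have : y (k + 1) - y i - (((k + 1 : ℤ) : ℝ) - i) • w =
        (y k - y i - ((k : ℝ) - i) • w) + (y (k + 1) - y k - w) := by
      push_cast
      module
    rw [this]
    refine (norm_add_le _ _).trans ?_
    push_cast
    linarith

lemma norm_sub_sub_zsmul_le_abs {E : Type*} [NormedAddCommGroup E] [NormedSpace ℝ E]
    (y : ℤ → E) (w : E) (η : ℝ) (i k : ℤ)
    (h : ∀ j, min i k ≤ j → j < max i k → ‖y (j + 1) - y j - w‖ ≤ η) :
    ‖y k - y i - ((k : ℝ) - i) • w‖ ≤ |(k : ℝ) - i| * η := by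
  rcases le_total i k with hik | hik
  · rw [abs_of_nonneg (by simpa using hik)]
    exact norm_sub_sub_zsmul_le y w η hik (by simpa [hik] using h)
  · rw [abs_of_nonpos (by simpa using hik), ← norm_neg]
    have := norm_sub_sub_zsmul_le y w η hik (by simpa [hik] using h)
    rw [show -(y k - y i - ((k : ℝ) - i) • w) = y i - y k - ((i : ℝ) - k) • w by module, neg_sub]
    exact this

/-- Bounding a sequence by its initial value and bounds on its increments. -/
lemma le_sum_Ico_of_increment_le (u e : ℤ → ℝ) {a k : ℤ} (hak : a ≤ k)
    (h : ∀ j, u (j + 1) - u j ≤ e j) : u k ≤ u a + (∑ j ∈ Finset.Ico a k, e j) := by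
  induction k, hak using Int.leInduction with
  | base => simp
  | succ k hk ih =>
    rw [← Finset.insert_Ico_right_eq_Ico_add_one hk, Finset.sum_insert (by simp)]
    linarith [h k]


lemma norm_sq_le_sum_Ico {E : Type*} [NormedAddCommGroup E]
    {h : ℝ} (hh : 0 < h) (x : ℤ → E) {a k : ℤ} (hak : a ≤ k) (ha : x a = 0) :
    ‖x k‖ ^ 2 ≤ (1 + h) * ∑ j ∈ Finset.Ico a k, (‖x (j + 1) - x j‖ ^ 2 / h + h * ‖x j‖ ^ 2) := by
  have := le_sum_Ico_of_increment_le (fun j => ‖x j‖ ^ 2)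
    (fun j => (1 + h) * (‖x (j + 1) - x j‖ ^ 2 / h + h * ‖x j‖ ^ 2)) hak ?_
  · simpa [ha, Finset.mul_sum] using this
  · intro j
    have h1 : ‖x (j + 1)‖ ≤ ‖x j‖ + ‖x (j + 1) - x j‖ := norm_le_norm_add_norm_sub' _ _
    have h0 := norm_nonneg (x (j + 1))
    have h2 : ‖x (j + 1)‖ ^ 2 ≤ (‖x j‖ + ‖x (j + 1) - x j‖) ^ 2 := by gcongr
    set p := ‖x j‖
    set d := ‖x (j + 1) - x j‖
    have h3 : 2 * p * d ≤ d ^ 2 / h + h * p ^ 2 := by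
      have : d ^ 2 / h + h * p ^ 2 - 2 * p * d = (d - h * p) ^ 2 / h := by field_simp; ring
      have : 0 ≤ (d - h * p) ^ 2 / h := by positivity
      linarith
    have h4 : (1 + h) * (d ^ 2 / h + h * p ^ 2) = d ^ 2 / h + h * p ^ 2 + d ^ 2 + h * (h * p ^ 2) := by
      field_simp
      ring
    have : 0 ≤ h * (h * p ^ 2) := by positivity
    rw [h4]
    nlinarith

/-- Local discrete Sobolev inequality on a window of unit length. -/
lemma norm_sq_le_window {E : Type*} [NormedAddCommGroup E]
    {N : ℕ} (hN : 0 < N) (x : ℤ → E) {a i : ℤ} (hi : i ∈ Finset.Ico a (a + N)) :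
    ‖x i‖ ^ 2 ≤ 2 * ∑ j ∈ Finset.Ico a (a + N),
      (‖x (j + 1) - x j‖ ^ 2 / (1 / N : ℝ) + (1 / N : ℝ) * ‖x j‖ ^ 2) := by
  set I := Finset.Ico a (a + N) with hI
  set V := ∑ j ∈ I, ‖x (j + 1) - x j‖ with hV
  have hcard : I.card = N := by simp [hI]
  have hNr : (0 : ℝ) < N := by exact_mod_cast hN
  have key : ∀ j ∈ I, ‖x i‖ ≤ ‖x j‖ + V := by
    intro j hj
    rw [hI, Finset.mem_Ico] at hi hj
    rcases le_total j i with hji | hij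
    · refine (le_sum_Ico_of_increment_le (fun j => ‖x j‖) (fun j => ‖x (j + 1) - x j‖) hji
        fun j => norm_sub_norm_le _ _).trans ?_
      gcongr
      refine Finset.sum_le_sum_of_subset_of_nonneg ?_ fun _ _ _ => norm_nonneg _
      exact Finset.Ico_subset_Ico hj.1 hi.2.le
    · have := le_sum_Ico_of_increment_le (fun j => -‖x j‖) (fun j => ‖x (j + 1) - x j‖) hij
        fun j => by
          have := norm_sub_norm_le (x j) (x (j + 1))
          rw [norm_sub_rev] at this
          linarith
      have h2 : ∑ j ∈ Finset.Ico i j, ‖x (j + 1) - x j‖ ≤ V := by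
        refine Finset.sum_le_sum_of_subset_of_nonneg ?_ fun _ _ _ => norm_nonneg _
        exact Finset.Ico_subset_Ico hi.1 hj.2.le
      linarith
  have key2 : ∀ j ∈ I, ‖x i‖ ^ 2 ≤ 2 * ‖x j‖ ^ 2 + 2 * V ^ 2 := by
    intro j hj
    have h1 := key j hj
    have h0 := norm_nonneg (x i)
    have : ‖x i‖ ^ 2 ≤ (‖x j‖ + V) ^ 2 := by gcongr
    nlinarith [sq_nonneg (‖x j‖ - V)]
  have h3 := Finset.sum_le_sum key2
  rw [Finset.sum_const, hcard, Finset.sum_add_distrib, Finset.sum_const, hcard,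
    ← Finset.mul_sum, nsmul_eq_mul, nsmul_eq_mul] at h3
  have h4 : V ^ 2 ≤ N * ∑ j ∈ I, ‖x (j + 1) - x j‖ ^ 2 := by
    have := sq_sum_le_card_mul_sum_sq (s := I) (f := fun j => ‖x (j + 1) - x j‖)
    rwa [hcard] at this
  rw [Finset.sum_add_distrib, ← Finset.mul_sum, ← Finset.sum_div]
  rw [← mul_le_mul_iff_right₀ hNr]
  refine h3.trans ?_
  have : (N : ℝ) * (2 * ((∑ j ∈ I, ‖x (j + 1) - x j‖ ^ 2) / (1 / N : ℝ)
      + 1 / (N : ℝ) * ∑ j ∈ I, ‖x j‖ ^ 2)) = 2 * ∑ j ∈ I, ‖x j‖ ^ 2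
      + N * (2 * (N * ∑ j ∈ I, ‖x (j + 1) - x j‖ ^ 2)) := by
    field_simp
    ring
  rw [this]
  gcongr

lemma exists_discrete_solution {E : Type*} [NormedAddCommGroup E] [InnerProductSpace ℝ E]
    [ProperSpace E] {h c : ℝ} (hh : 0 < h) (hh1 : h ≤ 1) (hc : c ≤ 1) {A : ℤ}
    (G : ℤ → E → ℝ) (g : ℤ → E → E) (hG : ∀ i y, HasFDerivAt (G i) (innerSL ℝ (g i y)) y)
    (hG0 : ∀ i, G i 0 = 0) (γ : ℤ → ℝ)
    (hGγ : ∀ i y, ‖y‖ ≤ 1 → c / 2 * ‖y‖ ^ 2 - γ i ≤ G i y)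
    (hγ : h * ∑ i ∈ Finset.Ico (-A) A, γ i < c / 4) :
    ∃ x : ℤ → E, (∀ i, ‖x i‖ ≤ 1) ∧ (∀ i, i ≤ -A ∨ A ≤ i → x i = 0) ∧
      (∑ i ∈ Finset.Ico (-A) A, (‖x (i + 1) - x i‖ ^ 2 / h + h * ‖x i‖ ^ 2) ≤ 1 / 2) ∧
      ∀ i, -A < i → i < A → (x (i + 1) - x i) - (x i - x (i - 1)) = h ^ 2 • g i (x i) := by
  set En : (ℤ → E) → ℝ := fun x => ∑ i ∈ Finset.Ico (-A) A,
    (‖x (i + 1) - x i‖ ^ 2 / h + h * ‖x i‖ ^ 2) with hEn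
  set J : (ℤ → E) → ℝ := fun x => ∑ i ∈ Finset.Ico (-A) A,
    (‖x (i + 1) - x i‖ ^ 2 / (2 * h) + h * G i (x i)) with hJ
  set S : Set (ℤ → E) := {x | (∀ i, ‖x i‖ ≤ 1) ∧ (∀ i, i ≤ -A ∨ A ≤ i → x i = 0) ∧
    En x ≤ 1 / 2} with hS
  have hGc : ∀ i, Continuous (G i) := fun i =>
    continuous_iff_continuousAt.2 fun y => (hG i y).continuousAt
  have hEnc : Continuous En := by fun_prop
  have hJc : Continuous J := by fun_prop
  have hScomp : IsCompact S := by
    have h1 : IsCompact (Set.pi Set.univ fun _ : ℤ => Metric.closedBall (0 : E) 1) :=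
      isCompact_univ_pi fun _ => isCompact_closedBall _ _
    refine h1.of_isClosed_subset ?_ ?_
    · rw [hS, Set.ofPred_and, Set.ofPred_and]
      refine IsClosed.inter ?_ (IsClosed.inter ?_ (isClosed_le hEnc continuous_const))
      · rw [Set.ofPred_forall]
        exact isClosed_iInter fun i => isClosed_le (by fun_prop) continuous_const
      · simp only [Set.ofPred_forall]
        exact isClosed_iInter fun i => isClosed_iInter fun _ =>
          isClosed_eq (by fun_prop) continuous_const
    · intro x hx i _
      simpa using hx.1 i
  have h0S : (0 : ℤ → E) ∈ S := by simp [hS, hEn]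
  obtain ⟨x, hxS, hxmin⟩ := hScomp.exists_isMinOn ⟨0, h0S⟩ hJc.continuousOn
  have hJx : J x ≤ 0 := by
    have : J x ≤ J 0 := hxmin h0S
    simpa [hJ, hG0] using this
  obtain ⟨hx1, hx0, hxE⟩ := id hxS
  have hstrict : En x < 1 / 2 := by
    have h1 : c / 2 * En x - h * ∑ i ∈ Finset.Ico (-A) A, γ i ≤ J x := by
      simp only [hEn, hJ, Finset.mul_sum, ← Finset.sum_sub_distrib]
      refine Finset.sum_le_sum fun i _ => ?_
      have h2 := mul_le_mul_of_nonneg_left (hGγ i (x i) (hx1 i)) hh.le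
      have h3 : c * (‖x (i + 1) - x i‖ ^ 2 / (2 * h)) ≤ 1 * (‖x (i + 1) - x i‖ ^ 2 / (2 * h)) := by
        gcongr
      have h4 : c / 2 * (‖x (i + 1) - x i‖ ^ 2 / h) = c * (‖x (i + 1) - x i‖ ^ 2 / (2 * h)) := by
        field_simp
      rw [mul_add, h4]
      nlinarith
    by_contra hcon
    have h5 : En x = 1 / 2 := le_antisymm hxE (not_lt.1 hcon)
    rw [h5] at h1
    linarith
  refine ⟨x, hx1, hx0, hxE, fun i hi1 hi2 => ?_⟩
  have hcrit : ∀ u : E, ⟪(x i - x (i - 1)) - (x (i + 1) - x i) + h ^ 2 • g i (x i), u⟫ = 0 := by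
    intro u
    set w : ℤ → E := Pi.single i u with hw
    have hwi : w i = u := by simp [hw]
    have hwne : ∀ j, j ≠ i → w j = 0 := fun j hj => by simp [hw, hj]
    have hz : Continuous fun s : ℝ => x + s • w := by fun_prop
    have hmem : ∀ᶠ s in nhds (0 : ℝ), x + s • w ∈ S := by
      have : ∀ᶠ s in nhds (0 : ℝ), En (x + s • w) < 1 / 2 := by
        refine (hEnc.comp hz).continuousAt.eventually_lt continuousAt_const ?_
        simpa using hstrict
      filter_upwards [this] with s hs
      have hzero : ∀ j, j ≤ -A ∨ A ≤ j → (x + s • w) j = 0 := by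
        intro j hj
        have : j ≠ i := by omega
        simp [hx0 j hj, hwne j this]
      refine ⟨fun j => ?_, hzero, hs.le⟩
      by_cases hj : j ≤ -A ∨ A ≤ j
      · simp [hzero j hj]
      · have h1 := norm_sq_le_sum_Ico hh (x + s • w) (a := -A) (k := j) (by omega)
          (hzero _ (Or.inl le_rfl))
        have h2 : ∑ l ∈ Finset.Ico (-A) j, (‖(x + s • w) (l + 1) - (x + s • w) l‖ ^ 2 / h
            + h * ‖(x + s • w) l‖ ^ 2) ≤ En (x + s • w) := by
          refine Finset.sum_le_sum_of_subset_of_nonneg ?_ fun _ _ _ => by positivity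
          exact Finset.Ico_subset_Ico le_rfl (by omega)
        have h3 : 0 ≤ En (x + s • w) := Finset.sum_nonneg fun _ _ => by positivity
        have h4 : ‖(x + s • w) j‖ ^ 2 ≤ 1 := by nlinarith
        nlinarith [norm_nonneg ((x + s • w) j)]
    have hloc : IsLocalMin (fun s : ℝ => J (x + s • w)) 0 := by
      filter_upwards [hmem] with s hs
      simpa using hxmin hs
    have hlin : ∀ j, HasDerivAt (fun s : ℝ => x j + s • w j) (w j) 0 := fun j => by
      simpa using ((hasDerivAt_id (0 : ℝ)).smul_const (w j)).const_add (x j)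
    have hder : HasDerivAt (fun s : ℝ => J (x + s • w))
        (∑ j ∈ Finset.Ico (-A) A, (2 * ⟪x (j + 1) - x j, w (j + 1) - w j⟫ / (2 * h)
          + h * ⟪g j (x j), w j⟫)) 0 := by
      simp only [hJ]
      refine HasDerivAt.fun_sum fun j _ => ?_
      refine HasDerivAt.add ?_ ?_
      · have := ((hlin (j + 1)).sub (hlin j)).norm_sq.div_const (2 * h)
        simpa using this
      · have h1 : HasFDerivAt (G j) (innerSL ℝ (g j (x j))) (x j + (0 : ℝ) • w j) := by
          simpa using hG j (x j)
        have := (h1.comp_hasDerivAt (0 : ℝ) (hlin j)).const_mul h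
        simpa using this
    have h0 := hloc.hasDerivAt_eq_zero hder
    have hs1 : ∑ j ∈ Finset.Ico (-A) A, ⟪x (j + 1) - x j, w (j + 1)⟫ = ⟪x i - x (i - 1), u⟫ := by
      rw [Finset.sum_eq_single (i - 1)]
      · simp [hwi]
      · intro j _ hj
        rw [hwne _ (by omega), inner_zero_right]
      · intro hj
        exact absurd (Finset.mem_Ico.2 ⟨by omega, by omega⟩) hj
    have hs2 : ∀ a : ℤ → E, ∑ j ∈ Finset.Ico (-A) A, ⟪a j, w j⟫ = ⟪a i, u⟫ := by
      intro a
      rw [Finset.sum_eq_single i]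
      · simp [hwi]
      · intro j _ hj
        rw [hwne _ (by omega), inner_zero_right]
      · intro hj
        exact absurd (Finset.mem_Ico.2 ⟨by omega, by omega⟩) hj
    have h5 : ∑ j ∈ Finset.Ico (-A) A, (2 * ⟪x (j + 1) - x j, w (j + 1) - w j⟫ / (2 * h)
          + h * ⟪g j (x j), w j⟫) = h⁻¹ * (∑ j ∈ Finset.Ico (-A) A, ⟪x (j + 1) - x j, w (j + 1)⟫
          - ∑ j ∈ Finset.Ico (-A) A, ⟪x (j + 1) - x j, w j⟫)
          + h * ∑ j ∈ Finset.Ico (-A) A, ⟪g j (x j), w j⟫ := by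
      rw [← Finset.sum_sub_distrib, Finset.mul_sum, Finset.mul_sum, ← Finset.sum_add_distrib]
      refine Finset.sum_congr rfl fun j _ => ?_
      rw [inner_sub_right]
      field_simp
    rw [h5, hs1, hs2 (fun j => x (j + 1) - x j), hs2 (fun j => g j (x j))] at h0
    rw [inner_add_left, inner_sub_left (x i - x (i - 1)), real_inner_smul_left]
    have h6 : h * (h⁻¹ * (⟪x i - x (i - 1), u⟫ - ⟪x (i + 1) - x i, u⟫) + h * ⟪g i (x i), u⟫) = 0 := by
      rw [h0, mul_zero]
    rw [← h6]
    field_simp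
  have h7 := inner_self_eq_zero.1 (hcrit _)
  rw [← sub_eq_zero, ← neg_eq_zero, ← h7]
  abel

section DiscreteSolution

variable {E : Type*} [NormedAddCommGroup E] [NormedSpace ℝ E]

lemma discrete_velocity_sub_le {N : ℕ} (hN : 0 < N) {x r : ℤ → E} {A : ℤ}
    (heq : ∀ i, -A < i → i < A →
      (x (i + 1) - x i) - (x i - x (i - 1)) = (1 / N : ℝ) ^ 2 • r i)
    {w : E} {η : ℝ} {i k : ℤ} (hi : -A < i) (hi' : i < A) (hk : -A < k) (hk' : k < A)
    (hw : ∀ j, min i k ≤ j → j < max i k → ‖r (j + 1) - w‖ ≤ η) :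
    ‖(N : ℝ) • (x (k + 1) - x k) - (N : ℝ) • (x (i + 1) - x i) - (((k : ℝ) - i) / N) • w‖
      ≤ |(k : ℝ) - i| / N * η := by
  have hNr : (0 : ℝ) < N := by exact_mod_cast hN
  have := norm_sub_sub_zsmul_le_abs (fun j => (N : ℝ) • (x (j + 1) - x j)) ((1 / N : ℝ) • w)
    (1 / N * η) i k fun j hj hj' => by
      have h1 := heq (j + 1) (by omega) (by omega)
      rw [add_sub_cancel_right] at h1
      rw [← smul_sub, h1, smul_smul,
        show (N : ℝ) * (1 / N) ^ 2 = 1 / N by field_simp, ← smul_sub, norm_smul,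
        Real.norm_of_nonneg (by positivity)]
      gcongr
      exact hw j hj hj'
  rw [smul_smul, mul_one_div] at this
  refine this.trans (le_of_eq ?_)
  ring

lemma discrete_velocity_lipschitz {N : ℕ} (hN : 0 < N) {C : ℝ} {x r : ℤ → E} {A : ℤ}
    (hr : ∀ i, ‖r i‖ ≤ C)
    (heq : ∀ i, -A < i → i < A →
      (x (i + 1) - x i) - (x i - x (i - 1)) = (1 / N : ℝ) ^ 2 • r i)
    {i k : ℤ} (hi : -A < i) (hi' : i < A) (hk : -A < k) (hk' : k < A) :
    ‖(N : ℝ) • (x (k + 1) - x k) - (N : ℝ) • (x (i + 1) - x i)‖ ≤ |(k : ℝ) - i| / N * C := by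
  simpa using discrete_velocity_sub_le hN heq hi hi' hk hk' (w := 0)
    fun j _ _ => by simpa using hr (j + 1)

lemma discrete_taylor {N : ℕ} (hN : 0 < N) {C : ℝ} {x r : ℤ → E} {A : ℤ}
    (hr : ∀ i, ‖r i‖ ≤ C)
    (heq : ∀ i, -A < i → i < A →
      (x (i + 1) - x i) - (x i - x (i - 1)) = (1 / N : ℝ) ^ 2 • r i)
    {i k : ℤ} (hi : -A < i) (hi' : i < A) (hk : -A < k) (hk' : k < A) :
    ‖x k - x i - (((k : ℝ) - i) / N) • ((N : ℝ) • (x (i + 1) - x i))‖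
      ≤ (|(k : ℝ) - i| / N) ^ 2 * C := by
  have hNr : (0 : ℝ) < N := by exact_mod_cast hN
  have hC : 0 ≤ C := (norm_nonneg _).trans (hr 0)
  have := norm_sub_sub_zsmul_le_abs x (x (i + 1) - x i)
    (1 / N * (|(k : ℝ) - i| / N * C)) i k fun j hj hj' => by
      have h1 := discrete_velocity_lipschitz hN hr heq hi hi' (k := j) (by omega) (by omega)
      rw [← smul_sub, norm_smul, Real.norm_of_nonneg hNr.le] at h1
      have h2 : |(j : ℝ) - i| ≤ |(k : ℝ) - i| := by
        have : |j - i| ≤ |k - i| := by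
          rcases le_total i k with h | h
          · rw [min_eq_left h] at hj
            rw [abs_of_nonneg (by omega), abs_of_nonneg (by omega)]
            omega
          · rw [min_eq_right h] at hj
            rw [max_eq_left h] at hj'
            rw [abs_of_nonpos (by omega), abs_of_nonpos (by omega)]
            omega
        exact_mod_cast this
      rw [one_div, ← div_eq_inv_mul, le_div_iff₀' hNr]
      refine h1.trans ?_
      gcongr
  rw [smul_smul, div_mul_cancel₀ _ hNr.ne']
  refine this.trans (le_of_eq ?_)
  field_simp

lemma discrete_velocity_bound {N : ℕ} (hN : 0 < N) {C : ℝ} {x r : ℤ → E} {A : ℤ}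
    (hx : ∀ i, ‖x i‖ ≤ 1) (hr : ∀ i, ‖r i‖ ≤ C)
    (heq : ∀ i, -A < i → i < A →
      (x (i + 1) - x i) - (x i - x (i - 1)) = (1 / N : ℝ) ^ 2 • r i)
    {i : ℤ} (hi : -A < i) (hi' : i + N < A) :
    ‖(N : ℝ) • (x (i + 1) - x i)‖ ≤ 2 + C := by
  have hNr : (0 : ℝ) < N := by exact_mod_cast hN
  have h1 := discrete_taylor hN hr heq (k := i + N) hi (by omega) (by omega) hi'
  have h2 : (((i + N : ℤ) : ℝ) - i) = N := by push_cast; ring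
  rw [h2, abs_of_pos hNr, div_self hNr.ne', one_smul, one_pow, one_mul] at h1
  have h3 := norm_sub_norm_le ((N : ℝ) • (x (i + 1) - x i)) (x (i + N) - x i)
  rw [norm_sub_rev (_ • _)] at h3
  have h4 := norm_sub_le (x (i + N)) (x i)
  linarith [hx i, hx (i + N)]

lemma discrete_lipschitz {N : ℕ} (hN : 0 < N) {C : ℝ} {x r : ℤ → E} {A : ℤ}
    (hx : ∀ i, ‖x i‖ ≤ 1) (hr : ∀ i, ‖r i‖ ≤ C)
    (heq : ∀ i, -A < i → i < A →
      (x (i + 1) - x i) - (x i - x (i - 1)) = (1 / N : ℝ) ^ 2 • r i)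
    {i k : ℤ} (hi : -A < i) (hi' : i + N < A) (hk : -A < k) (hk' : k + N < A) :
    ‖x k - x i‖ ≤ |(k : ℝ) - i| / N * (2 + C) := by
  have hNr : (0 : ℝ) < N := by exact_mod_cast hN
  have := norm_sub_sub_zsmul_le_abs x 0 (1 / N * (2 + C)) i k fun j hj hj' => by
      have h1 := discrete_velocity_bound hN hx hr heq (i := j) (by omega) (by omega)
      rw [norm_smul, Real.norm_of_nonneg hNr.le] at h1
      rwa [sub_zero, one_div, ← div_eq_inv_mul, le_div_iff₀' hNr]
  rw [smul_zero, sub_zero] at this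
  refine this.trans (le_of_eq ?_)
  field_simp

end DiscreteSolution

lemma hasDerivAt_of_forall_norm_sub_le {E : Type*} [NormedAddCommGroup E] [NormedSpace ℝ E]
    {q : ℝ → E} {w : E} {s : ℝ}
    (h : ∀ ε > 0, ∃ δ > 0, ∀ t, |t - s| < δ → ‖q t - q s - (t - s) • w‖ ≤ |t - s| * ε) :
    HasDerivAt q w s := by
  rw [hasDerivAt_iff_isLittleO, Asymptotics.isLittleO_iff]
  intro ε hε
  obtain ⟨δ, hδ, H⟩ := h ε hε
  filter_upwards [Metric.ball_mem_nhds s hδ] with t ht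
  rw [Real.norm_eq_abs, mul_comm]
  exact H t (by simpa [Real.dist_eq] using ht)

lemma exists_tendsto_ultrafilter_of_norm_le {E ι : Type*} [NormedAddCommGroup E] [ProperSpace E]
    (U : Ultrafilter ι) (y : ι → E) (B : ℝ) (h : ∀ᶠ N in (U : Filter ι), ‖y N‖ ≤ B) :
    ∃ z, Tendsto y U (nhds z) := by
  obtain ⟨z, -, hz⟩ := (isCompact_closedBall (0 : E) B).ultrafilter_le_nhds (U.map y) (by
    rw [le_principal_iff, Ultrafilter.mem_coe, Ultrafilter.mem_map]
    filter_upwards [h] with N hN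
    simpa using hN)
  exact ⟨z, hz⟩

lemma tendsto_intFloor_mul_div (t : ℝ) :
    Tendsto (fun N : ℕ => (⌊t * N⌋ : ℝ) / N) atTop (nhds t) := by
  have h0 : Tendsto (fun N : ℕ => (N : ℝ)⁻¹) atTop (nhds 0) := tendsto_inv_atTop_nhds_zero_nat
  have h1 : Tendsto (fun N : ℕ => t - (N : ℝ)⁻¹) atTop (nhds t) := by
    simpa using h0.const_sub t
  refine tendsto_of_tendsto_of_tendsto_of_le_of_le' h1 tendsto_const_nhds ?_ ?_
  · filter_upwards [eventually_gt_atTop 0] with N hN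
    have hNr : (0 : ℝ) < N := by exact_mod_cast hN
    rw [le_div_iff₀ hNr, sub_mul, inv_mul_cancel₀ hNr.ne']
    exact (Int.sub_one_lt_floor _).le
  · filter_upwards [eventually_gt_atTop 0] with N hN
    have hNr : (0 : ℝ) < N := by exact_mod_cast hN
    rw [div_le_iff₀ hNr]
    exact Int.floor_le _

lemma eventually_intFloor_mul_mem (t : ℝ) :
    ∀ᶠ N : ℕ in atTop, 0 < N ∧ -((N : ℤ) * N) < ⌊t * N⌋ ∧ ⌊t * N⌋ + N < (N : ℤ) * N := by
  filter_upwards [eventually_gt_atTop 0, eventually_gt_atTop ⌈|t| + 2⌉₊] with N hN hN'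
  have hNr : (1 : ℝ) ≤ N := by exact_mod_cast hN
  have h1 : |t| + 2 < N := (Nat.le_ceil _).trans_lt (by exact_mod_cast hN')
  have h2 := Int.floor_le (t * N)
  have h3 := Int.sub_one_lt_floor (t * N)
  have h4 := le_abs_self t
  have h5 := neg_abs_le t
  refine ⟨hN, ?_, ?_⟩
  · have : (-((N : ℝ) * N)) < ⌊t * N⌋ := by nlinarith
    exact_mod_cast this
  · have : (⌊t * N⌋ : ℝ) + N < (N : ℝ) * N := by nlinarith
    exact_mod_cast this

lemma exists_decaying_limit_solution {E : Type*} [NormedAddCommGroup E] [NormedSpace ℝ E]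
    [ProperSpace E] {R : ℝ × E → E} (hR : Continuous R) {C : ℝ}
    (hC : ∀ t y, ‖y‖ ≤ 1 → ‖R (t, y)‖ ≤ C) (x : ℕ → ℤ → E) (σ : ℕ → ℤ → ℝ)
    (hx : ∀ N i, ‖x N i‖ ≤ 1)
    (hσ : ∀ N : ℕ, 0 < N → ∀ i : ℤ, (i : ℝ) / N ≤ σ N i ∧ σ N i ≤ ((i : ℝ) + 1) / N)
    (hen : ∀ N : ℕ, 0 < N → ∀ F : Finset ℤ, ∑ i ∈ F,
      (‖x N (i + 1) - x N i‖ ^ 2 / (1 / N : ℝ) + (1 / N : ℝ) * ‖x N i‖ ^ 2) ≤ 1 / 2)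
    (heq : ∀ N : ℕ, 0 < N → ∀ i : ℤ, -((N : ℤ) * N) < i → i < (N : ℤ) * N →
      (x N (i + 1) - x N i) - (x N i - x N (i - 1)) = (1 / N : ℝ) ^ 2 • R (σ N i, x N i)) :
    ∃ q v : ℝ → E, (∀ t, HasDerivAt q (v t) t) ∧ (∀ t, HasDerivAt v (R (t, q t)) t) ∧
      Tendsto q (cocompact ℝ) (nhds 0) ∧ Tendsto v (cocompact ℝ) (nhds 0) := by
  have hr : ∀ N i, ‖R (σ N i, x N i)‖ ≤ C := fun N i => hC _ _ (hx N i)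
  have hC0 : 0 ≤ C := (norm_nonneg _).trans (hr 0 0)
  set U : Ultrafilter ℕ := hyperfilter ℕ
  have hU : (U : Filter ℕ) ≤ atTop := Nat.hyperfilter_le_atTop
  have hmem : ∀ t : ℝ, ∀ᶠ N : ℕ in (U : Filter ℕ),
      0 < N ∧ -((N : ℤ) * N) < ⌊t * N⌋ ∧ ⌊t * N⌋ + N < (N : ℤ) * N :=
    fun t => (eventually_intFloor_mul_mem t).filter_mono hU
  have hd : ∀ t : ℝ, Tendsto (fun N : ℕ => (⌊t * N⌋ : ℝ) / N) U (nhds t) :=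
    fun t => (tendsto_intFloor_mul_div t).mono_left hU
  have hq : ∀ t : ℝ, ∃ z, Tendsto (fun N : ℕ => x N ⌊t * N⌋) U (nhds z) := fun t =>
    exists_tendsto_ultrafilter_of_norm_le U _ 1 (Eventually.of_forall fun N => hx _ _)
  have hv : ∀ t : ℝ, ∃ z,
      Tendsto (fun N : ℕ => (N : ℝ) • (x N (⌊t * N⌋ + 1) - x N ⌊t * N⌋)) U (nhds z) := fun t => by
    refine exists_tendsto_ultrafilter_of_norm_le U _ (2 + C) ?_
    filter_upwards [hmem t] with N ⟨hN, h1, h2⟩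
    exact discrete_velocity_bound hN (hx N) (hr N) (heq N hN) h1 h2
  choose q hq using hq
  choose v hv using hv
  have hdd : ∀ s t : ℝ,
      Tendsto (fun N : ℕ => ((⌊t * N⌋ : ℝ) - ⌊s * N⌋) / N) U (nhds (t - s)) := fun s t => by
    simpa only [sub_div] using (hd t).sub (hd s)
  have hdda : ∀ s t : ℝ,
      Tendsto (fun N : ℕ => |(⌊t * N⌋ : ℝ) - ⌊s * N⌋| / N) U (nhds |t - s|) := fun s t => by
    simpa only [abs_div, Nat.abs_cast] using (hdd s t).abs
  have htaylor : ∀ s t, ‖q t - q s - (t - s) • v s‖ ≤ |t - s| ^ 2 * C := by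
    intro s t
    refine le_of_tendsto_of_tendsto (((hq t).sub (hq s)).sub ((hdd s t).smul (hv s))).norm
      (((hdda s t).pow 2).mul_const C) ?_
    filter_upwards [hmem s, hmem t] with N ⟨hN, hs1, hs2⟩ ⟨_, ht1, ht2⟩
    exact discrete_taylor hN (hr N) (heq N hN) hs1 (by omega) ht1 (by omega)
  have hqder : ∀ s, HasDerivAt q (v s) s := by
    intro s
    refine hasDerivAt_of_forall_norm_sub_le fun ε hε => ⟨ε / (C + 1), by positivity, ?_⟩
    intro t ht
    refine (htaylor s t).trans ?_
    rw [sq, mul_assoc]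
    gcongr
    rw [lt_div_iff₀ (by positivity)] at ht
    nlinarith [abs_nonneg (t - s)]
  have hN0 : Tendsto (fun N : ℕ => (N : ℝ)⁻¹) U (nhds 0) :=
    tendsto_inv_atTop_nhds_zero_nat.mono_left hU
  have hvder : ∀ s, HasDerivAt v (R (s, q s)) s := by
    intro s
    refine hasDerivAt_of_forall_norm_sub_le fun ε hε => ?_
    obtain ⟨δ, hδ, hRδ⟩ := Metric.continuousAt_iff.1 (hR.continuousAt (x := (s, q s))) ε hε
    refine ⟨δ / (2 + C), by positivity, fun t ht => ?_⟩
    have ht1 : |t - s| * (2 + C) < δ := (lt_div_iff₀ (by positivity)).1 ht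
    have ht2 : |t - s| < δ := by nlinarith [abs_nonneg (t - s)]
    refine le_of_tendsto_of_tendsto (((hv t).sub (hv s)).sub
      ((hdd s t).smul_const (R (s, q s)))).norm ((hdda s t).mul_const ε) ?_
    have e1 : ∀ᶠ N : ℕ in (U : Filter ℕ), |(⌊s * N⌋ : ℝ) / N - s| + 2 * (N : ℝ)⁻¹ < δ := by
      have := (((hd s).sub_const s).abs).add (hN0.const_mul 2)
      refine this.eventually_lt_const ?_
      simpa using hδ
    have e2 : ∀ᶠ N : ℕ in (U : Filter ℕ), |(⌊t * N⌋ : ℝ) / N - s| + 2 * (N : ℝ)⁻¹ < δ := by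
      have := (((hd t).sub_const s).abs).add (hN0.const_mul 2)
      refine this.eventually_lt_const ?_
      simpa using ht2
    have e3 : ∀ᶠ N : ℕ in (U : Filter ℕ), |(⌊t * N⌋ : ℝ) - ⌊s * N⌋| / N * (2 + C)
        + ‖x N ⌊s * N⌋ - q s‖ < δ := by
      have := ((hdda s t).mul_const (2 + C)).add ((hq s).sub_const (q s)).norm
      refine this.eventually_lt_const ?_
      simpa using ht1
    filter_upwards [hmem s, hmem t, e1, e2, e3] with N ⟨hN, hs1, hs2⟩ ⟨_, ht1, ht2⟩ e1 e2 e3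
    have hNr : (0 : ℝ) < N := by exact_mod_cast hN
    refine discrete_velocity_sub_le hN (heq N hN) hs1 (by omega) ht1 (by omega) ?_
    intro j hj hj'
    rw [← dist_eq_norm]
    refine (hRδ ?_).le
    rw [Prod.dist_eq, max_lt_iff]
    constructor
    · have hσj := hσ N hN (j + 1)
      push_cast at hσj
      simp only [add_div, one_div] at hσj
      simp only [Real.dist_eq, abs_lt]
      have hj1 : (min (⌊s * N⌋ : ℝ) ⌊t * N⌋) / N ≤ j / N := by
        gcongr
        exact_mod_cast hj
      have hj2 : (j : ℝ) / N ≤ (max (⌊s * N⌋ : ℝ) ⌊t * N⌋) / N := by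
        gcongr
        exact_mod_cast hj'.le
      have hinv : 0 < (N : ℝ)⁻¹ := by positivity
      have a1 := abs_lt.1 (lt_sub_iff_add_lt.2 e1)
      have a2 := abs_lt.1 (lt_sub_iff_add_lt.2 e2)
      rw [← min_div_div_right hNr.le] at hj1
      rw [← max_div_div_right hNr.le] at hj2
      constructor
      · rcases min_le_iff.1 hj1 with h | h <;> linarith [hσj.1]
      · rcases le_max_iff.1 hj2 with h | h <;> linarith [hσj.2]
    · have h1 := discrete_lipschitz hN (hx N) (hr N) (heq N hN) hs1 hs2 (k := j + 1)
        (by omega) (by omega)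
      have h2 : |((j + 1 : ℤ) : ℝ) - ⌊s * N⌋| ≤ |(⌊t * N⌋ : ℝ) - ⌊s * N⌋| := by
        have : |j + 1 - ⌊s * N⌋| ≤ |⌊t * N⌋ - ⌊s * N⌋| := by
          rcases le_total ⌊s * N⌋ ⌊t * N⌋ with h | h
          · rw [min_eq_left h] at hj
            rw [max_eq_right h] at hj'
            rw [abs_of_nonneg (by omega), abs_of_nonneg (by omega)]
            omega
          · rw [min_eq_right h] at hj
            rw [max_eq_left h] at hj'
            rw [abs_of_nonpos (by omega), abs_of_nonpos (by omega)]
            omega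
        exact_mod_cast this
      refine (dist_triangle _ (x N ⌊s * N⌋) _).trans_lt ?_
      rw [dist_eq_norm, dist_eq_norm]
      refine lt_of_le_of_lt ?_ e3
      gcongr
      refine h1.trans ?_
      gcongr
  have hqlim : Tendsto q (cocompact ℝ) (nhds 0) := by
    have hterm : ∀ N : ℕ, ∀ i, 0 ≤ ‖x N (i + 1) - x N i‖ ^ 2 / (1 / N : ℝ)
        + (1 / N : ℝ) * ‖x N i‖ ^ 2 := fun N i => by positivity
    have he : ∀ k : ℤ, ∃ z, Tendsto (fun N : ℕ => ∑ i ∈ Finset.Ico (k * N) (k * N + N),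
        (‖x N (i + 1) - x N i‖ ^ 2 / (1 / N : ℝ) + (1 / N : ℝ) * ‖x N i‖ ^ 2)) U (nhds z) := by
      intro k
      refine exists_tendsto_ultrafilter_of_norm_le U _ (1 / 2) ?_
      filter_upwards [hmem 0] with N hN
      rw [Real.norm_of_nonneg (Finset.sum_nonneg fun i _ => hterm N i)]
      exact hen N hN.1 _
    choose e he using he
    have he0 : ∀ k, 0 ≤ e k := fun k =>
      ge_of_tendsto' (he k) fun N => Finset.sum_nonneg fun i _ => hterm N i
    have hesum : Summable e := by
      refine summable_of_sum_le (c := 1 / 2) he0 fun F => ?_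
      refine le_of_tendsto (tendsto_finsetSum F fun k _ => he k) ?_
      filter_upwards [hmem 0] with N hN
      rw [← Finset.sum_biUnion]
      · exact hen N hN.1 _
      · intro k _ l _ hkl
        have hNz : (0 : ℤ) < N := by exact_mod_cast hN.1
        rw [Function.onFun, Finset.disjoint_left]
        intro a ha hb
        rw [Finset.mem_Ico] at ha hb
        apply hkl
        have h1 : k < l + 1 := lt_of_mul_lt_mul_right (by nlinarith) hNz.le
        have h2 : l < k + 1 := lt_of_mul_lt_mul_right (by nlinarith) hNz.le
        omega
    have hqe : ∀ t, ‖q t‖ ^ 2 ≤ 2 * e ⌊t⌋ := by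
      intro t
      refine le_of_tendsto_of_tendsto ((hq t).norm.pow 2) ((he ⌊t⌋).const_mul 2) ?_
      filter_upwards [hmem 0] with N hN
      have hNr : (0 : ℝ) < N := by exact_mod_cast hN.1
      refine norm_sq_le_window hN.1 (x N) (Finset.mem_Ico.2 ⟨?_, ?_⟩)
      · rw [Int.le_floor]
        push_cast
        have := Int.floor_le t
        gcongr
      · rw [Int.floor_lt]
        push_cast
        have := Int.lt_floor_add_one t
        nlinarith
    have hfl : Tendsto (fun t : ℝ => ⌊t⌋) (cocompact ℝ) cofinite := by
      rw [cocompact_eq_atBot_atTop, Int.cofinite_eq]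
      exact tendsto_floor_atBot.sup_sup tendsto_floor_atTop
    have h0 : Tendsto (fun t => 2 * e ⌊t⌋) (cocompact ℝ) (nhds 0) := by
      simpa using (hesum.tendsto_cofinite_zero.comp hfl).const_mul 2
    have h1 := squeeze_zero (fun t => sq_nonneg ‖q t‖) hqe h0
    rw [tendsto_zero_iff_norm_tendsto_zero]
    have := h1.sqrt
    simpa using this
  refine ⟨q, v, hqder, hvder, hqlim, ?_⟩
  rw [Metric.tendsto_nhds]
  intro ε hε
  set δ : ℝ := ε / (2 * (C + 1)) with hδ
  have hδ0 : 0 < δ := by positivity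
  have hshift : Tendsto (fun t : ℝ => q (t + δ)) (cocompact ℝ) (nhds 0) :=
    hqlim.comp (Homeomorph.addRight δ).isClosedEmbedding.tendsto_cocompact
  have hqn := Metric.tendsto_nhds.1 hqlim (δ * ε / 4) (by positivity)
  have hqs := Metric.tendsto_nhds.1 hshift (δ * ε / 4) (by positivity)
  filter_upwards [hqn, hqs] with t h1 h2
  rw [dist_zero_right] at *
  have h3 := htaylor t (t + δ)
  rw [add_sub_cancel_left, abs_of_pos hδ0] at h3
  have h4 : ‖δ • v t‖ ≤ ‖q (t + δ)‖ + ‖q t‖ + δ ^ 2 * C := by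
    have : δ • v t = q (t + δ) - q t - (q (t + δ) - q t - δ • v t) := by abel
    rw [this]
    refine (norm_sub_le _ _).trans ?_
    gcongr
    exact norm_sub_le _ _
  rw [norm_smul, Real.norm_of_nonneg hδ0.le] at h4
  have h5 : δ * (C + 1) = ε / 2 := by rw [hδ]; field_simp
  have h6 : δ ^ 2 * C ≤ δ * (ε / 2) := by
    rw [← h5]
    nlinarith [sq_nonneg δ]
  refine lt_of_mul_lt_mul_left (a := δ) ?_ hδ0.le
  linarith

lemma superquadratic_le_mul_norm_sq {E : Type*} [NormedAddCommGroup E] [InnerProductSpace ℝ E]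
    {V : E → ℝ} {g : E → E} (hV : ∀ y, HasFDerivAt V (innerSL ℝ (g y)) y)
    (hsuper : ∀ y, y ≠ 0 → 2 * V y ≤ ⟪y, g y⟫) {M : ℝ} (hM : ∀ y, ‖y‖ = 1 → V y ≤ M)
    {y : E} (hy0 : y ≠ 0) (hy : ‖y‖ ≤ 1) : V y ≤ M * ‖y‖ ^ 2 := by
  have hyn : 0 < ‖y‖ := norm_pos_iff.2 hy0
  set u : E := ‖y‖⁻¹ • y with hu
  have hu1 : ‖u‖ = 1 := by
    rw [hu, norm_smul, norm_inv, norm_norm, inv_mul_cancel₀ hyn.ne']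
  have hu0 : u ≠ 0 := fun h => by simp [h] at hu1
  have hder : ∀ s : ℝ, 0 < s → HasDerivAt (fun s : ℝ => V (s • u) / s ^ 2)
      ((⟪g (s • u), u⟫ * s ^ 2 - V (s • u) * (2 * s)) / (s ^ 2) ^ 2) s := by
    intro s hs
    have h1 : HasDerivAt (fun s : ℝ => s • u) u s := by
      simpa using (hasDerivAt_id s).smul_const u
    have h2 : HasDerivAt (fun s : ℝ => V (s • u)) ⟪g (s • u), u⟫ s := by
      exact (hV (s • u)).comp_hasDerivAt s h1
    have h3 : HasDerivAt (fun s : ℝ => s ^ 2) (2 * s) s := by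
      simpa using hasDerivAt_pow 2 s
    exact h2.fun_div h3 (by positivity)
  have hmono : MonotoneOn (fun s : ℝ => V (s • u) / s ^ 2) (Set.Ioi 0) := by
    refine monotoneOn_of_deriv_nonneg (convex_Ioi 0)
      (fun s hs => (hder s hs).continuousAt.continuousWithinAt)
      (fun s hs => ?_) fun s hs => ?_
    · rw [interior_Ioi] at hs
      exact (hder s hs).differentiableAt.differentiableWithinAt
    · rw [interior_Ioi] at hs
      have hs' : 0 < s := hs
      rw [(hder s hs).deriv]
      refine div_nonneg ?_ (by positivity)
      have h1 := hsuper (s • u) (smul_ne_zero hs'.ne' hu0)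
      rw [real_inner_smul_left, real_inner_comm] at h1
      nlinarith
  have h1 := hmono (Set.mem_Ioi.2 hyn) (Set.mem_Ioi.2 one_pos) hy
  simp only [one_smul, one_pow, div_one] at h1
  have h2 : ‖y‖ • u = y := by rw [hu, smul_smul, mul_inv_cancel₀ hyn.ne', one_smul]
  rw [h2, div_le_iff₀ (by positivity)] at h1
  refine h1.trans ?_
  gcongr
  exact hM u hu1

section Gradient

variable {E : Type*} [NormedAddCommGroup E] [InnerProductSpace ℝ E] [CompleteSpace E]

lemma hasFDerivAt_innerSL_gradient {K : ℝ → E → ℝ} (hK : ContDiff ℝ 1 (Function.uncurry K))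
    (t : ℝ) (y : E) : HasFDerivAt (K t) (innerSL ℝ (gradient (K t) y)) y := by
  have h1 : DifferentiableAt ℝ (K t) y := by
    have : Differentiable ℝ fun y => Function.uncurry K (t, y) :=
      (hK.differentiable one_ne_zero).comp (by fun_prop)
    exact this y
  exact h1.hasGradientAt.hasFDerivAt

lemma continuous_uncurry_gradient {K : ℝ → E → ℝ} (hK : ContDiff ℝ 1 (Function.uncurry K)) :
    Continuous fun p : ℝ × E => gradient (K p.1) p.2 := by
  have h1 : ∀ p : ℝ × E, fderiv ℝ (K p.1) p.2 =
      (fderiv ℝ (Function.uncurry K) p).comp (ContinuousLinearMap.inr ℝ ℝ E) := by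
    intro p
    have h2 : HasFDerivAt (fun y : E => (p.1, y)) (ContinuousLinearMap.inr ℝ ℝ E) p.2 :=
      hasFDerivAt_prodMk_right p.1 p.2
    exact (((hK.differentiable one_ne_zero p).hasFDerivAt).comp p.2 h2).fderiv
  unfold gradient
  simp_rw [h1]
  have := hK.continuous_fderiv one_ne_zero
  fun_prop

end Gradient

/-- Sampling a continuous integrable function at well-chosen points of a uniform grid gives
Riemann sums bounded by its integral. -/
lemma exists_sample_points {φ : ℝ → ℝ} (hφ : Continuous φ) (hφ0 : ∀ t, 0 ≤ φ t)
    (hint : Integrable φ) {h : ℝ} (hh : 0 < h) :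
    ∃ σ : ℤ → ℝ, (∀ i : ℤ, i * h ≤ σ i ∧ σ i ≤ (i + 1) * h) ∧
      ∀ F : Finset ℤ, h * ∑ i ∈ F, φ (σ i) ≤ ∫ t, φ t := by
  have hex : ∀ i : ℤ, ∃ s ∈ Set.Icc ((i : ℝ) * h) ((i + 1) * h),
      IsMinOn φ (Set.Icc ((i : ℝ) * h) ((i + 1) * h)) s := fun i =>
    isCompact_Icc.exists_isMinOn ⟨_, Set.left_mem_Icc.2 (by nlinarith)⟩ hφ.continuousOn
  choose σ hσ hmin using hex
  refine ⟨σ, fun i => hσ i, fun F => ?_⟩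
  set I : ℤ → Set ℝ := fun i => Set.Ioc ((i : ℝ) * h) ((i + 1) * h) with hI
  have hdisj : (F : Set ℤ).Pairwise (Function.onFun Disjoint I) := by
    intro k _ l _ hkl
    rw [Function.onFun, Set.disjoint_left]
    intro a ha hb
    apply hkl
    have h1 : (k : ℝ) < l + 1 := lt_of_mul_lt_mul_right (ha.1.trans_le hb.2) hh.le
    have h2 : (l : ℝ) < k + 1 := lt_of_mul_lt_mul_right (hb.1.trans_le ha.2) hh.le
    have h1' : k < l + 1 := by exact_mod_cast h1
    have h2' : l < k + 1 := by exact_mod_cast h2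
    omega
  calc h * ∑ i ∈ F, φ (σ i) = ∑ i ∈ F, ∫ t in I i, φ (σ i) := by
        rw [Finset.mul_sum]
        refine Finset.sum_congr rfl fun i _ => ?_
        rw [setIntegral_const, hI, Real.volume_real_Ioc_of_le (by nlinarith), smul_eq_mul]
        ring
    _ ≤ ∑ i ∈ F, ∫ t in I i, φ t := by
        refine Finset.sum_le_sum fun i _ => ?_
        refine setIntegral_mono_on (integrableOn_const (by simp [hI])) hint.integrableOn
          measurableSet_Ioc fun t ht => ?_
        exact hmin i (Set.Ioc_subset_Icc_self ht)
    _ = ∫ t in ⋃ i ∈ F, I i, φ t :=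
        (integral_biUnion_finset F (fun _ _ => measurableSet_Ioc) hdisj
          fun _ _ => hint.integrableOn).symm
    _ ≤ ∫ t, φ t := setIntegral_le_integral hint (Eventually.of_forall hφ0)

lemma lt_sq_of_rpow_half_lt {a b : ℝ} (ha : 0 ≤ a) (h : a ^ ((1 : ℝ) / 2) < b) : a < b ^ 2 := by
  rw [← Real.sqrt_eq_rpow] at h
  have := pow_lt_pow_left₀ h (Real.sqrt_nonneg a) two_ne_zero
  rwa [Real.sq_sqrt ha] at this

/-- A potential that is coercive on the unit ball up to a small forcing term gives rise to a
solution on the whole line that vanishes at infinity together with its velocity. -/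
lemma exists_homoclinic_of_potential {E : Type*} [NormedAddCommGroup E] [InnerProductSpace ℝ E]
    [ProperSpace E] {G : ℝ → E → ℝ} {R : ℝ × E → E} (hR : Continuous R)
    (hGd : ∀ t y, HasFDerivAt (G t) (innerSL ℝ (R (t, y))) y) (hG0 : ∀ t, G t 0 = 0)
    {C : ℝ} (hC : ∀ t y, ‖y‖ ≤ 1 → ‖R (t, y)‖ ≤ C) {c : ℝ} (hc0 : 0 < c) (hc1 : c ≤ 1)
    {f : ℝ → E} (hf : Continuous f) (hfsq : Integrable fun t => ‖f t‖ ^ 2)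
    (hΦ : ∫ t, ‖f t‖ ^ 2 < c ^ 2 / 2)
    (hGf : ∀ t y, ‖y‖ ≤ 1 → c / 2 * ‖y‖ ^ 2 - ‖f t‖ ^ 2 / (2 * c) ≤ G t y) :
    ∃ q v : ℝ → E, (∀ t, HasDerivAt q (v t) t) ∧ (∀ t, HasDerivAt v (R (t, q t)) t) ∧
      Tendsto q (cocompact ℝ) (nhds 0) ∧ Tendsto v (cocompact ℝ) (nhds 0) := by
  have hdisc : ∀ N : ℕ, ∃ (x : ℤ → E) (σ : ℤ → ℝ), (∀ i, ‖x i‖ ≤ 1) ∧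
      (0 < N → (∀ i : ℤ, (i : ℝ) / N ≤ σ i ∧ σ i ≤ ((i : ℝ) + 1) / N) ∧
        (∀ F : Finset ℤ, ∑ i ∈ F,
          (‖x (i + 1) - x i‖ ^ 2 / (1 / N : ℝ) + (1 / N : ℝ) * ‖x i‖ ^ 2) ≤ 1 / 2) ∧
        ∀ i : ℤ, -((N : ℤ) * N) < i → i < (N : ℤ) * N →
          (x (i + 1) - x i) - (x i - x (i - 1)) = (1 / N : ℝ) ^ 2 • R (σ i, x i)) := by
    intro N
    rcases Nat.eq_zero_or_pos N with rfl | hN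
    · exact ⟨0, 0, by simp, fun h => absurd h (lt_irrefl 0)⟩
    have hNr : (1 : ℝ) ≤ N := by exact_mod_cast hN
    have hh : (0 : ℝ) < 1 / N := by positivity
    have hh1 : (1 / N : ℝ) ≤ 1 := by rwa [div_le_one (by positivity)]
    obtain ⟨σ, hσ, hsum⟩ := exists_sample_points (φ := fun t => ‖f t‖ ^ 2) (by fun_prop)
      (fun t => by positivity) hfsq hh
    have hγ : (1 / N : ℝ) * ∑ i ∈ Finset.Ico (-((N : ℤ) * N)) ((N : ℤ) * N),
        ‖f (σ i)‖ ^ 2 / (2 * c) < c / 4 := by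
      rw [← Finset.sum_div, mul_div_assoc', div_lt_iff₀ (by positivity)]
      refine (hsum _).trans_lt (hΦ.trans_eq ?_)
      ring
    obtain ⟨x, hx1, hx0, hxE, hxeq⟩ := exists_discrete_solution hh hh1 hc1
      (fun i => G (σ i)) (fun i y => R (σ i, y)) (fun i => hGd (σ i)) (fun i => hG0 (σ i))
      (fun i => ‖f (σ i)‖ ^ 2 / (2 * c)) (fun i => hGf (σ i)) hγ
    refine ⟨x, σ, hx1, fun _ => ⟨fun i => ?_, fun F => ?_, hxeq⟩⟩
    · have := hσ i
      rwa [mul_one_div, mul_one_div] at this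
    · refine le_trans ?_ hxE
      rw [← Finset.sum_filter_of_ne (p := (· ∈ Finset.Ico (-((N : ℤ) * N)) ((N : ℤ) * N)))]
      · exact Finset.sum_le_sum_of_subset_of_nonneg (fun i hi => (Finset.mem_filter.1 hi).2)
          fun _ _ _ => by positivity
      · intro i _ hi
        by_contra hcon
        rw [Finset.mem_Ico] at hcon
        have e1 : x i = 0 := hx0 i (by omega)
        have e2 : x (i + 1) = 0 := hx0 (i + 1) (by omega)
        simp [e1, e2] at hi
  choose x σ hx1 hrest using hdisc
  exact exists_decaying_limit_solution hR hC x σ hx1 (fun N hN => (hrest N hN).1)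
    (fun N hN => (hrest N hN).2.1) (fun N hN => (hrest N hN).2.2)

lemma contDiff_two_of_hasDerivAt {E : Type*} [NormedAddCommGroup E] [NormedSpace ℝ E]
    {q v : ℝ → E} {R : ℝ × E → E} (hq : ∀ t, HasDerivAt q (v t) t)
    (hv : ∀ t, HasDerivAt v (R (t, q t)) t) (hR : Continuous R) : ContDiff ℝ 2 q := by
  have hqc : Continuous q := continuous_iff_continuousAt.2 fun t => (hq t).continuousAt
  have hdq : deriv q = v := funext fun t => (hq t).deriv
  have hdv : deriv v = fun t => R (t, q t) := funext fun t => (hv t).deriv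
  have h1 : ContDiff ℝ 1 v := by
    rw [contDiff_one_iff_deriv, hdv]
    exact ⟨fun t => (hv t).differentiableAt, hR.comp (by fun_prop)⟩
  rw [show (2 : WithTop ℕ∞) = 1 + 1 by norm_num, contDiff_succ_iff_deriv, hdq]
  exact ⟨fun t => (hq t).differentiableAt, by simp, h1⟩

/-- Under conditions (C1)–(C6) on the potentials `K`, `W`, with
`M := sup {W t q : ‖q‖ = 1}`, `b̄₁ := min 1 (2 b₁)`, `M < b̄₁ / 2`, and a continuous,
bounded forcing term `f` whose `L²` norm is less than `(√2/4)(b̄₁ - 2M)`, the system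
`q̈ - ∇_q K(t,q) + ∇_q W(t,q) = f` has a homoclinic-type solution. -/
theorem stmt0 {n : ℕ}
    (K W : ℝ → EuclideanSpace ℝ (Fin n) → ℝ)
    (hKsmooth : ContDiff ℝ 1 (Function.uncurry K))
    (hWsmooth : ContDiff ℝ 1 (Function.uncurry W))
    -- (C1)
    (hC1 : ∀ L > (0:ℝ), ∃ C > (0:ℝ), ∀ (t : ℝ) (q : EuclideanSpace ℝ (Fin n)), ‖q‖ ≤ L →
      ‖gradient (K t) q‖ ≤ C ∧ ‖gradient (W t) q‖ ≤ C)
    -- (C2)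
    (b₁ b₂ : ℝ) (hb₁ : 0 < b₁) (hb₂ : 0 < b₂)
    (hC2 : ∀ (t : ℝ) (q : EuclideanSpace ℝ (Fin n)),
      b₁ * ‖q‖ ^ 2 ≤ K t q ∧ K t q ≤ b₂ * ‖q‖ ^ 2)
    -- (C3)
    (hC3 : ∀ (t : ℝ) (q : EuclideanSpace ℝ (Fin n)),
      K t q ≤ ⟪q, gradient (K t) q⟫ ∧ ⟪q, gradient (K t) q⟫ ≤ 2 * K t q)
    -- (C4)
    (hC4 : ∀ ε > (0:ℝ), ∃ δ > (0:ℝ), ∀ (t : ℝ) (q : EuclideanSpace ℝ (Fin n)),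
      ‖q‖ ≤ δ → ‖gradient (W t) q‖ ≤ ε * ‖q‖)
    -- (C5)
    (μ : ℝ) (hμ : 2 < μ)
    (hC5 : ∀ (t : ℝ) (q : EuclideanSpace ℝ (Fin n)), q ≠ 0 →
      0 < μ * W t q ∧ μ * W t q ≤ ⟪q, gradient (W t) q⟫)
    -- (C6)
    (m : ℝ)
    (hm : IsGLB {y : ℝ | ∃ (t : ℝ) (q : EuclideanSpace ℝ (Fin n)), ‖q‖ = 1 ∧ y = W t q} m)
    (hm0 : 0 < m)
    -- M and the smallness assumptions
    (M : ℝ)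
    (hM : IsLUB {y : ℝ | ∃ (t : ℝ) (q : EuclideanSpace ℝ (Fin n)), ‖q‖ = 1 ∧ y = W t q} M)
    (hMsmall : M < (1 / 2) * min 1 (2 * b₁))
    (f : ℝ → EuclideanSpace ℝ (Fin n))
    (hfcont : Continuous f) (hfbdd : ∃ C : ℝ, ∀ t : ℝ, ‖f t‖ ≤ C)
    (hfsq : Integrable (fun t : ℝ => ‖f t‖ ^ 2))
    (hfsmall : (∫ t : ℝ, ‖f t‖ ^ 2) ^ ((1:ℝ)/2) <
      Real.sqrt 2 / 4 * (min 1 (2 * b₁) - 2 * M)) :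
    ∃ q : ℝ → EuclideanSpace ℝ (Fin n), ContDiff ℝ 2 q ∧
      (∀ t : ℝ, deriv (deriv q) t - gradient (K t) (q t) + gradient (W t) (q t) = f t) ∧
      Tendsto q atTop (nhds 0) ∧ Tendsto q atBot (nhds 0) ∧
      Tendsto (deriv q) atTop (nhds 0) ∧ Tendsto (deriv q) atBot (nhds 0) := by
  obtain ⟨t₀, q₀, hq₀⟩ : ∃ (t : ℝ) (q : EuclideanSpace ℝ (Fin n)), ‖q‖ = 1 := by
    by_contra hcon
    push Not at hcon
    have := hM.2 (show M - 1 ∈ upperBounds _ by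
      rintro y ⟨t, q, hq, -⟩
      exact absurd hq (hcon t q))
    linarith
  have hM0 : 0 < M := hm0.trans_le ((hm.1 ⟨t₀, q₀, hq₀, rfl⟩).trans (hM.1 ⟨t₀, q₀, hq₀, rfl⟩))
  have hKd := hasFDerivAt_innerSL_gradient hKsmooth
  have hWd := hasFDerivAt_innerSL_gradient hWsmooth
  have hWM : ∀ t q, q ≠ 0 → ‖q‖ ≤ 1 → W t q ≤ M * ‖q‖ ^ 2 := fun t q hq0 hq1 =>
    superquadratic_le_mul_norm_sq (hWd t) (fun y hy => by
      have h1 := hC5 t y hy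
      have h2 : 0 < W t y := pos_of_mul_pos_right h1.1 (by linarith)
      nlinarith) (fun y hy => hM.1 ⟨t, y, hy, rfl⟩) hq0 hq1
  have hW0 : ∀ t, W t 0 = 0 := by
    intro t
    have hlim : Tendsto (fun s : ℝ => W t (s • q₀)) (nhdsWithin 0 (Set.Ioi 0)) (nhds (W t 0)) := by
      have hc : Continuous fun s : ℝ => Function.uncurry W (t, s • q₀) :=
        hWsmooth.continuous.comp (by fun_prop)
      have := (hc.tendsto 0).mono_left (nhdsWithin_le_nhds (s := Set.Ioi 0))
      simpa using this
    have hq₀0 : q₀ ≠ 0 := fun h => by simp [h] at hq₀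
    have hlim2 : Tendsto (fun s : ℝ => M * s ^ 2) (nhdsWithin 0 (Set.Ioi 0)) (nhds 0) := by
      have hc : Continuous fun s : ℝ => M * s ^ 2 := by fun_prop
      simpa using (hc.tendsto 0).mono_left (nhdsWithin_le_nhds (s := Set.Ioi 0))
    refine le_antisymm (le_of_tendsto_of_tendsto hlim hlim2 ?_) (ge_of_tendsto hlim ?_)
    · filter_upwards [Ioc_mem_nhdsGT (zero_lt_one' ℝ)] with s hs
      have hsn : ‖s • q₀‖ = s := by rw [norm_smul, hq₀, mul_one, Real.norm_of_nonneg hs.1.le]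
      have := hWM t (s • q₀) (smul_ne_zero hs.1.ne' hq₀0) (by rw [hsn]; exact hs.2)
      rwa [hsn] at this
    · filter_upwards [self_mem_nhdsWithin] with s hs
      have hs' : s ≠ 0 := ne_of_gt hs
      exact (pos_of_mul_pos_right (hC5 t (s • q₀) (smul_ne_zero hs' hq₀0)).1 (by linarith)).le
  have hGd : ∀ t y, HasFDerivAt (fun y => K t y - W t y + ⟪f t, y⟫)
      (innerSL ℝ (gradient (K t) y - gradient (W t) y + f t)) y := fun t y => by
    have h1 : HasFDerivAt (fun y => ⟪f t, y⟫) (innerSL ℝ (f t)) y := (innerSL ℝ (f t)).hasFDerivAt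
    simpa only [map_add, map_sub] using ((hKd t y).fun_sub (hWd t y)).fun_add h1
  have hK0 : ∀ t, K t 0 = 0 := fun t => by
    have := hC2 t 0
    simp only [norm_zero] at this
    linarith
  set c : ℝ := 1 / 2 * min 1 (2 * b₁) - M with hc
  have hc0 : 0 < c := by linarith
  have hc1 : c ≤ 1 := by linarith [min_le_left 1 (2 * b₁)]
  have hcb : c ≤ b₁ - M := by linarith [min_le_right 1 (2 * b₁)]
  have hΦ : ∫ t : ℝ, ‖f t‖ ^ 2 < c ^ 2 / 2 := by
    have hnn : 0 ≤ ∫ t : ℝ, ‖f t‖ ^ 2 := integral_nonneg fun t => by positivity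
    have h1 := lt_sq_of_rpow_half_lt hnn hfsmall
    rw [mul_pow, div_pow, Real.sq_sqrt (by norm_num)] at h1
    refine h1.trans_eq ?_
    rw [hc]
    ring
  have hcoer : ∀ t y, ‖y‖ ≤ 1 →
      c / 2 * ‖y‖ ^ 2 - ‖f t‖ ^ 2 / (2 * c) ≤ K t y - W t y + ⟪f t, y⟫ := by
    intro t y hy
    have h1 := (hC2 t y).1
    have h2 : W t y ≤ M * ‖y‖ ^ 2 := by
      by_cases hy0 : y = 0
      · simp [hy0, hW0]
      · exact hWM _ y hy0 hy
    have h3 := (abs_le.1 (abs_real_inner_le_norm (f t) y)).1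
    have h4 : c * ‖y‖ ^ 2 ≤ (b₁ - M) * ‖y‖ ^ 2 := by gcongr
    have h5 : ‖f t‖ * ‖y‖ ≤ c / 2 * ‖y‖ ^ 2 + ‖f t‖ ^ 2 / (2 * c) := by
      have e1 : c / 2 * ‖y‖ ^ 2 + ‖f t‖ ^ 2 / (2 * c) - ‖f t‖ * ‖y‖
          = (c * ‖y‖ - ‖f t‖) ^ 2 / (2 * c) := by
        field_simp
        ring
      have e2 : 0 ≤ (c * ‖y‖ - ‖f t‖) ^ 2 / (2 * c) := by positivity
      linarith
    linarith
  obtain ⟨C₁, hC₁, hgrad⟩ := hC1 1 one_pos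
  obtain ⟨C₂, hC₂⟩ := hfbdd
  obtain ⟨q, v, hq, hv, hq0, hv0⟩ := exists_homoclinic_of_potential
    (R := fun p : ℝ × EuclideanSpace ℝ (Fin n) =>
      gradient (K p.1) p.2 - gradient (W p.1) p.2 + f p.1)
    (((continuous_uncurry_gradient hKsmooth).sub (continuous_uncurry_gradient hWsmooth)).add
      (hfcont.comp continuous_fst)) hGd (fun t => by simp [hK0, hW0]) (C := C₁ + C₁ + C₂)
    (fun t y hy => (norm_add_le _ _).trans (add_le_add ((norm_sub_le _ _).trans
      (add_le_add (hgrad t y hy).1 (hgrad t y hy).2)) (hC₂ t)))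
    hc0 hc1 hfcont hfsq hΦ hcoer
  have hdq : deriv q = v := funext fun t => (hq t).deriv
  have hdv : deriv v = fun t => gradient (K t) (q t) - gradient (W t) (q t) + f t :=
    funext fun t => (hv t).deriv
  have hsmooth : ContDiff ℝ 2 q :=
    contDiff_two_of_hasDerivAt hq hv (((continuous_uncurry_gradient hKsmooth).sub
      (continuous_uncurry_gradient hWsmooth)).add (hfcont.comp continuous_fst))
  rw [cocompact_eq_atBot_atTop, tendsto_sup] at hq0 hv0
  refine ⟨q, hsmooth, fun t => ?_, hq0.2, hq0.1, ?_, ?_⟩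
  · rw [hdq, hdv]
    simp only
    abel
  · rw [hdq]
    exact hv0.2
  · rw [hdq]
    exact hv0.1
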